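/- Let d ≥ 1, let α, ε, σ, R > 0, and let e : ℝ^d → ℝ be convex and Lipschitz continuous on ℝ^d such that x ↦ e(x) − (α/2)‖x‖₂² is convex on closedBall(0, R + ε) (i.e., e is α-strongly convex there). Suppose ε/σ ≥ 10·d, let Σ be a d×d positive definite matrix with Σ ⪯ σ²·I_d, let μ ∈ closedBall(0, R), let λ ∈ (0,1), and let X ~ N(μ, Σ). Define s(x) = E[(1 − 1/λ)·e(X) + (1/λ)·e((1−λ)·X + λ·x)]. Then the map x ↦ s(x) − (λα/4)‖x‖₂² is convex on closedBall(0, R); i.e., s is (λα/2)-strongly convex on closedBall(0, R). -/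

import Mathlib

open MeasureTheory Matrix

/-- The density of the Gaussian distribution `N(μ, Σ)` on `ℝ^d` (for `Σ` positive
definite) with respect to Lebesgue measure. -/
noncomputable def gaussPdf (d : ℕ) (μ : Fin d → ℝ) (S : Matrix (Fin d) (Fin d) ℝ)
    (x : Fin d → ℝ) : ℝ :=
  (2 * Real.pi) ^ (-(d : ℝ) / 2) * Real.sqrt S.det⁻¹ *
    Real.exp (-(1 / 2) * ((x - μ) ⬝ᵥ S⁻¹.mulVec (x - μ)))

open ProbabilityTheory in
/-- Standard Gaussian weight. -/
noncomputable def stdW (d : ℕ) (u : Fin d → ℝ) : ℝ := ∏ i, gaussianPDFReal 0 1 (u i)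

lemma stdW_nonneg (d : ℕ) (u : Fin d → ℝ) : 0 ≤ stdW d u :=
  Finset.prod_nonneg fun _ _ => ProbabilityTheory.gaussianPDFReal_nonneg _ _ _

lemma stdW_integrable (d : ℕ) : Integrable (stdW d) := by
  unfold stdW
  exact Integrable.fintype_prod (f := fun _ : Fin d => ProbabilityTheory.gaussianPDFReal 0 1)
    fun _ => ProbabilityTheory.integrable_gaussianPDFReal 0 1

lemma stdW_integral (d : ℕ) : ∫ u, stdW d u = 1 := by
  unfold stdW
  rw [integral_fintype_prod_volume_eq_prod (fun _ : Fin d => ProbabilityTheory.gaussianPDFReal 0 1)]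
  simp [ProbabilityTheory.integral_gaussianPDFReal_eq_one 0 (one_ne_zero)]

lemma sq_pdf_integral : ∫ x, x ^ 2 * ProbabilityTheory.gaussianPDFReal 0 1 x = 1 := by
  have h := ProbabilityTheory.variance_fun_id_gaussianReal (μ := 0) (v := 1)
  rw [ProbabilityTheory.variance_eq_integral (by fun_prop)] at h
  simp only [ProbabilityTheory.integral_id_gaussianReal, sub_zero] at h
  rw [ProbabilityTheory.integral_gaussianReal_eq_integral_smul one_ne_zero] at h
  simpa [mul_comm] using h

lemma sq_pdf_integrable :
    Integrable (fun x => x ^ 2 * ProbabilityTheory.gaussianPDFReal 0 1 x) := by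
  by_contra h
  have := integral_undef h
  rw [sq_pdf_integral] at this
  norm_num at this

lemma sq_stdW_eq (d : ℕ) (i : Fin d) (u : Fin d → ℝ) :
    u i ^ 2 * stdW d u = ∏ j, (if j = i then fun x : ℝ => x ^ 2 *
      ProbabilityTheory.gaussianPDFReal 0 1 x else ProbabilityTheory.gaussianPDFReal 0 1) (u j) := by
  have : ∀ j, (if j = i then fun x : ℝ => x ^ 2 *
      ProbabilityTheory.gaussianPDFReal 0 1 x else ProbabilityTheory.gaussianPDFReal 0 1) (u j)
      = (if j = i then u j ^ 2 else 1) * ProbabilityTheory.gaussianPDFReal 0 1 (u j) := by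
    intro j; split_ifs <;> simp
  simp only [this, Finset.prod_mul_distrib, stdW]
  simp

lemma sq_stdW_integrable (d : ℕ) (i : Fin d) :
    Integrable (fun u => u i ^ 2 * stdW d u) := by
  simp only [sq_stdW_eq]
  refine Integrable.fintype_prod (f := fun j => if j = i then fun x : ℝ => x ^ 2 *
      ProbabilityTheory.gaussianPDFReal 0 1 x else ProbabilityTheory.gaussianPDFReal 0 1) fun j => ?_
  split_ifs
  · exact sq_pdf_integrable
  · exact ProbabilityTheory.integrable_gaussianPDFReal 0 1

lemma sq_stdW_integral (d : ℕ) (i : Fin d) :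
    ∫ u, u i ^ 2 * stdW d u = 1 := by
  simp only [sq_stdW_eq]
  rw [integral_fintype_prod_volume_eq_prod (fun j => if j = i then fun x : ℝ => x ^ 2 *
      ProbabilityTheory.gaussianPDFReal 0 1 x else ProbabilityTheory.gaussianPDFReal 0 1)]
  refine Finset.prod_eq_one fun j _ => ?_
  split_ifs
  · exact sq_pdf_integral
  · exact ProbabilityTheory.integral_gaussianPDFReal_eq_one 0 one_ne_zero

lemma sumsq_stdW_integrable (d : ℕ) :
    Integrable (fun u => (∑ i, u i ^ 2) * stdW d u) := by
  simp only [Finset.sum_mul]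
  exact integrable_finsetSum _ fun i _ => sq_stdW_integrable d i

lemma sumsq_stdW_integral (d : ℕ) :
    ∫ u, (∑ i, u i ^ 2) * stdW d u = d := by
  simp only [Finset.sum_mul]
  rw [integral_finsetSum _ fun i _ => sq_stdW_integrable d i]
  simp [sq_stdW_integral]

open scoped MatrixOrder in
lemma exists_sqrt (d : ℕ) (S : Matrix (Fin d) (Fin d) ℝ) (hS : S.PosDef) :
    ∃ A : Matrix (Fin d) (Fin d) ℝ, A * A = S ∧ Aᵀ = A := by
  refine ⟨CFC.sqrt S, CFC.sqrt_mul_sqrt_self S hS.posSemidef.nonneg, ?_⟩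
  have := (CFC.sqrt_nonneg S).posSemidef.isHermitian
  simpa [Matrix.IsHermitian] using this

lemma gauss_cov (d : ℕ) (μ : Fin d → ℝ) (S A : Matrix (Fin d) (Fin d) ℝ) (hS : S.PosDef)
    (hA : A * A = S) (hAt : Aᵀ = A) (f : (Fin d → ℝ) → ℝ) :
    ∫ y, f y * gaussPdf d μ S y = ∫ u, f (μ + A.mulVec u) * stdW d u := by
  have hdet : S.det = A.det * A.det := by rw [← hA, det_mul]
  have hAd : A.det ≠ 0 := by
    intro h
    have := hS.det_pos
    rw [hdet, h] at this; simp at this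
  have hAu : IsUnit A.det := isUnit_iff_ne_zero.mpr hAd
  let f' : (Fin d → ℝ) →L[ℝ] (Fin d → ℝ) := (Matrix.toLin' A).toContinuousLinearMap
  have hf' : ∀ u, f' u = A.mulVec u := fun u => by simp [f']
  have hinj : Function.Injective (fun u => μ + A.mulVec u) := by
    intro u v h
    have h2 : A.mulVec u = A.mulVec v := by simpa using h
    have := congrArg (A⁻¹.mulVec) h2
    simpa [mulVec_mulVec, nonsing_inv_mul A hAu] using this
  have hsurj : Function.Surjective (fun u => μ + A.mulVec u) := by
    intro y
    refine ⟨A⁻¹.mulVec (y - μ), ?_⟩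
    simp [mulVec_mulVec, mul_nonsing_inv A hAu]
  have key := integral_image_eq_integral_abs_det_fderiv_smul (volume : Measure (Fin d → ℝ))
    (s := Set.univ) MeasurableSet.univ (f := fun u => μ + A.mulVec u) (f' := fun _ => f')
    (fun x _ => by
      have : (fun u => μ + A.mulVec u) = fun u => μ + f' u := by funext u; rw [hf']
      rw [this]
      exact (f'.hasFDerivAt.const_add μ).hasFDerivWithinAt)
    hinj.injOn (fun y => f y * gaussPdf d μ S y)
  rw [Set.image_univ, hsurj.range_eq, setIntegral_univ, setIntegral_univ] at key
  rw [key]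
  congr 1
  funext u
  have hd' : f'.det = A.det := by
    simp [f', ContinuousLinearMap.det, LinearMap.det_toLin']
  have hq : (A.mulVec u) ⬝ᵥ S⁻¹.mulVec (A.mulVec u) = ∑ i, u i ^ 2 := by
    have h1 : S⁻¹.mulVec (A.mulVec u) = A⁻¹.mulVec u := by
      rw [← hA, Matrix.mul_inv_rev, mulVec_mulVec, Matrix.mul_assoc, nonsing_inv_mul A hAu, Matrix.mul_one]
    have h2 : A.mulVec u = Matrix.vecMul u A := by
      conv_lhs => rw [← hAt]
      rw [mulVec_transpose]
    rw [h1, h2, ← dotProduct_mulVec, mulVec_mulVec, mul_nonsing_inv A hAu, one_mulVec]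
    simp [dotProduct, sq]
  have hpdf : |A.det| * gaussPdf d μ S (μ + A.mulVec u) = stdW d u := by
    unfold gaussPdf stdW
    rw [add_sub_cancel_left, hq, hdet, Real.sqrt_inv, Real.sqrt_mul_self_eq_abs]
    simp only [ProbabilityTheory.gaussianPDFReal, Finset.prod_mul_distrib, ← Real.exp_sum]
    have e1 : (2 * Real.pi) ^ (-(d : ℝ) / 2) = ∏ i : Fin d, (√(2 * Real.pi * (1 : NNReal)))⁻¹ := by
      have hp : 0 ≤ 2 * Real.pi := by positivity
      simp only [Finset.prod_const, Finset.card_univ, Fintype.card_fin, NNReal.coe_one, mul_one]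
      rw [Real.sqrt_eq_rpow, ← Real.rpow_neg hp, ← Real.rpow_natCast, ← Real.rpow_mul hp]
      congr 1; ring
    rw [e1]
    have e2 : -(1 / 2) * ∑ i, u i ^ 2 = ∑ i, -(u i - 0) ^ 2 / (2 * ((1 : NNReal) : ℝ)) := by
      rw [Finset.mul_sum]
      refine Finset.sum_congr rfl fun i _ => ?_
      simp; ring
    rw [e2]
    have : |A.det| ≠ 0 := abs_ne_zero.mpr hAd
    field_simp
  simp only [hd', smul_eq_mul]
  rw [← hpdf]; ring

lemma A_bound (d : ℕ) (σ : ℝ) (S A : Matrix (Fin d) (Fin d) ℝ)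
    (hA : A * A = S) (hAt : Aᵀ = A)
    (hSle : ((σ ^ 2) • (1 : Matrix (Fin d) (Fin d) ℝ) - S).PosSemidef) (u : Fin d → ℝ) :
    ∑ i, (A.mulVec u) i ^ 2 ≤ σ ^ 2 * ∑ i, u i ^ 2 := by
  have h := hSle.dotProduct_mulVec_nonneg u
  have h2 : A.mulVec u = Matrix.vecMul u A := by
    conv_lhs => rw [← hAt]
    rw [mulVec_transpose]
  have h3 : (A.mulVec u) ⬝ᵥ (A.mulVec u) = u ⬝ᵥ S.mulVec u := by
    conv_lhs => enter [1]; rw [h2]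
    rw [← dotProduct_mulVec, mulVec_mulVec, hA]
  have h4 : ∑ i, (A.mulVec u) i ^ 2 = u ⬝ᵥ S.mulVec u := by
    rw [← h3]; simp [dotProduct, sq]
  have h5 : u ⬝ᵥ u = ∑ i, u i ^ 2 := by simp [dotProduct, sq]
  simp only [star_trivial, sub_mulVec, smul_mulVec, one_mulVec, dotProduct_sub, dotProduct_smul, smul_eq_mul] at h
  rw [h4, ← h5]; linarith

lemma sumsq_eq (d : ℕ) (x : Fin d → ℝ) : ∑ i, x i ^ 2 = ‖WithLp.toLp 2 x‖ ^ 2 := by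
  rw [EuclideanSpace.norm_sq_eq]; simp

lemma lip_integrable (d : ℕ) (L : NNReal) (e : (Fin d → ℝ) → ℝ) (he : LipschitzWith L e)
    (A : Matrix (Fin d) (Fin d) ℝ) (b : Fin d → ℝ) (c : ℝ) :
    Integrable (fun u => e (b + c • A.mulVec u) * stdW d u) := by
  let g : (Fin d → ℝ) →L[ℝ] (Fin d → ℝ) := c • (Matrix.toLin' A).toContinuousLinearMap
  have hg : ∀ u, c • A.mulVec u = g u := fun u => by simp [g]
  simp only [hg]
  have hdom : Integrable (fun u => ((|e b| + L * ‖g‖) * stdW d u +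
      (L * ‖g‖) * ((∑ i, u i ^ 2) * stdW d u))) :=
    ((stdW_integrable d).const_mul _).add ((sumsq_stdW_integrable d).const_mul _)
  refine hdom.mono' ?_ (Filter.Eventually.of_forall fun u => ?_)
  · refine AEStronglyMeasurable.mul ?_ (stdW_integrable d).aestronglyMeasurable
    have : Continuous fun u => e (b + g u) := he.continuous.comp (by fun_prop)
    exact this.aestronglyMeasurable
  · rw [norm_mul, Real.norm_of_nonneg (stdW_nonneg d u), ← mul_assoc, ← add_mul]
    refine mul_le_mul_of_nonneg_right ?_ (stdW_nonneg d u)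
    have h1 : ‖e (b + g u) - e b‖ ≤ L * ‖g u‖ := by
      simpa [dist_eq_norm] using he.dist_le_mul (b + g u) b
    have h2 : ‖g u‖ ≤ ‖g‖ * ‖u‖ := g.le_opNorm u
    have h3 : ‖u‖ ≤ 1 + ∑ i, u i ^ 2 := by
      have hs : 0 ≤ ∑ i, u i ^ 2 := Finset.sum_nonneg fun i _ => sq_nonneg _
      refine (pi_norm_le_iff_of_nonneg (by linarith)).2 fun i => ?_
      have := Finset.single_le_sum (f := fun i => u i ^ 2) (fun i _ => sq_nonneg _) (Finset.mem_univ i)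
      rw [Real.norm_eq_abs]
      have h4 := sq_abs (u i)
      nlinarith [sq_nonneg (|u i| - 1)]
    have h4 : ‖e (b + g u)‖ ≤ |e b| + L * ‖g u‖ := by
      have := norm_sub_norm_le (e (b + g u)) (e b)
      rw [Real.norm_eq_abs (e b)] at this; linarith
    have h5 : L * ‖g u‖ ≤ L * (‖g‖ * (1 + ∑ i, u i ^ 2)) := by gcongr; exact h2.trans (by gcongr)
    nlinarith

lemma sumsq_comb (d : ℕ) (a b : ℝ) (hab : a + b = 1) (z z' : Fin d → ℝ) :
    ∑ i, (a • z + b • z') i ^ 2 =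
      a * ∑ i, z i ^ 2 + b * ∑ i, z' i ^ 2 - a * b * ∑ i, (z i - z' i) ^ 2 := by
  simp only [Finset.mul_sum, ← Finset.sum_add_distrib, ← Finset.sum_sub_distrib]
  refine Finset.sum_congr rfl fun i _ => ?_
  obtain rfl : b = 1 - a := by linarith
  simp only [Pi.add_apply, Pi.smul_apply, smul_eq_mul]
  ring

lemma sq_ball_add (d : ℕ) (x y : Fin d → ℝ) (r s : ℝ) (hr : 0 ≤ r) (hs : 0 ≤ s)
    (hx : ∑ i, x i ^ 2 ≤ r ^ 2) (hy : ∑ i, y i ^ 2 ≤ s ^ 2) :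
    ∑ i, (x + y) i ^ 2 ≤ (r + s) ^ 2 := by
  rw [sumsq_eq] at *
  have h1 := abs_le_of_sq_le_sq hx hr
  have h2 := abs_le_of_sq_le_sq hy hs
  have h3 : ‖WithLp.toLp 2 (x + y)‖ ≤ r + s := by
    rw [WithLp.toLp_add]
    exact (norm_add_le _ _).trans (add_le_add ((le_abs_self _).trans h1) ((le_abs_self _).trans h2))
  gcongr

lemma ball_convex (d : ℕ) (r : ℝ) : Convex ℝ {x : Fin d → ℝ | ∑ i, x i ^ 2 ≤ r ^ 2} := by
  intro x hx y hy a b ha hb hab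
  simp only [Set.mem_setOf_eq] at *
  rw [sumsq_comb d a b hab]
  have : 0 ≤ a * b * ∑ i, (x i - y i) ^ 2 :=
    mul_nonneg (mul_nonneg ha hb) (Finset.sum_nonneg fun i _ => sq_nonneg _)
  nlinarith [mul_le_mul_of_nonneg_left hx ha, mul_le_mul_of_nonneg_left hy hb]

/-- If `e : ℝ^d → ℝ` is convex, Lipschitz, and `α`-strongly convex on the Euclidean
ball of radius `R + ε` (i.e. `x ↦ e x − (α/2)‖x‖₂²` is convex there), `ε/σ ≥ 10 d`,
`0 ≺ Σ ⪯ σ² I`, `‖μ‖₂ ≤ R`, `λ ∈ (0,1)` and `X ~ N(μ, Σ)`, then the Gaussian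
optimistic smoothing surrogate
`s(x) = E[(1 − 1/λ) e(X) + (1/λ) e((1−λ)X + λx)]` is `(λα/2)`-strongly convex on the
Euclidean ball of radius `R`, i.e. `x ↦ s x − (λα/4)‖x‖₂²` is convex there. -/
theorem stmt_19 (d : ℕ) (hd : 1 ≤ d) (α ε σ R : ℝ)
    (hα : 0 < α) (hε : 0 < ε) (hσ : 0 < σ) (hR : 0 < R)
    (e : (Fin d → ℝ) → ℝ)
    (hconv : ConvexOn ℝ Set.univ e) (hlip : ∃ L : NNReal, LipschitzWith L e)
    (hsc : ConvexOn ℝ {x : Fin d → ℝ | ∑ i, x i ^ 2 ≤ (R + ε) ^ 2}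
      (fun x => e x - α / 2 * ∑ i, x i ^ 2))
    (hεσ : 10 * d ≤ ε / σ)
    (S : Matrix (Fin d) (Fin d) ℝ) (hS : S.PosDef)
    (hSle : ((σ ^ 2) • (1 : Matrix (Fin d) (Fin d) ℝ) - S).PosSemidef)
    (μ : Fin d → ℝ) (hμ : ∑ i, μ i ^ 2 ≤ R ^ 2)
    (lam : ℝ) (hlam0 : 0 < lam) (hlam1 : lam < 1) :
    ConvexOn ℝ {x : Fin d → ℝ | ∑ i, x i ^ 2 ≤ R ^ 2}
      (fun x =>
        (∫ y : Fin d → ℝ,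
            ((1 - 1 / lam) * e y + (1 / lam) * e ((1 - lam) • y + lam • x)) *
              gaussPdf d μ S y) -
          lam * α / 4 * ∑ i, x i ^ 2) := by
  obtain ⟨L, hL⟩ := hlip
  obtain ⟨A, hA, hAt⟩ := exists_sqrt d S hS
  simp only [gauss_cov d μ S A hS hA hAt]
  refine ⟨ball_convex d R, ?_⟩
  intro x hx x' hx' a b ha hb hab
  simp only [Set.mem_setOf_eq] at hx hx'
  have hd1 : (1 : ℝ) ≤ d := by exact_mod_cast hd
  set t : ℝ := ε / σ with ht
  have ht0 : 0 < t := by positivity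
  set D : ℝ := ∑ i, (x i - x' i) ^ 2 with hD
  have hD0 : 0 ≤ D := Finset.sum_nonneg fun i _ => sq_nonneg _
  set c : ℝ := lam * α / 2 * (a * b) * D with hc
  have hc0 : 0 ≤ c := by positivity
  let F : (Fin d → ℝ) → (Fin d → ℝ) → ℝ := fun x y =>
    (1 - 1 / lam) * e y + (1 / lam) * e ((1 - lam) • y + lam • x)
  -- integrability
  have hFint : ∀ x, Integrable (fun u => F x (μ + A.mulVec u) * stdW d u) := by
    intro x
    have h1 := (lip_integrable d L e hL A μ 1).const_mul (1 - 1 / lam)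
    have h2 := (lip_integrable d L e hL A ((1 - lam) • μ + lam • x) (1 - lam)).const_mul (1 / lam)
    refine (h1.add h2).congr (Filter.Eventually.of_forall fun u => ?_)
    have h3 : (1 - lam) • μ + lam • x + (1 - lam) • A.mulVec u
        = (1 - lam) • (μ + A.mulVec u) + lam • x := by
      rw [smul_add]; abel
    simp only [Pi.add_apply, one_smul, h3, F]
    ring
  -- pointwise inequality
  have hpt : ∀ u, F (a • x + b • x') (μ + A.mulVec u) ≤
      a * F x (μ + A.mulVec u) + b * F x' (μ + A.mulVec u)
        - c * (1 - (∑ i, u i ^ 2) / t ^ 2) := by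
    intro u
    set y := μ + A.mulVec u with hy
    set q := ∑ i, u i ^ 2 with hq
    have hq0 : 0 ≤ q := Finset.sum_nonneg fun i _ => sq_nonneg _
    set z := (1 - lam) • y + lam • x with hz
    set z' := (1 - lam) • y + lam • x' with hz'
    have hzz : (1 - lam) • y + lam • (a • x + b • x') = a • z + b • z' := by
      obtain rfl : b = 1 - a := by linarith
      rw [hz, hz']; module
    have hl : 0 < 1 / lam := by positivity
    suffices h : e (a • z + b • z') ≤ a * e z + b * e z' - lam * c * (1 - q / t ^ 2) by
      have h2 := mul_le_mul_of_nonneg_left h hl.le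
      have h3 : 1 / lam * (a * e z + b * e z' - lam * c * (1 - q / t ^ 2)) =
        a * (1 / lam * e z) + b * (1 / lam * e z') - c * (1 - q / t ^ 2) := by
        field_simp
      have h4 : (1 - 1 / lam) * e y = a * ((1 - 1 / lam) * e y) + b * ((1 - 1 / lam) * e y) := by
        rw [← add_mul, hab, one_mul]
      simp only [F, hzz]
      linarith
    by_cases hqt : q ≤ t ^ 2
    · have hAu : ∑ i, (A.mulVec u) i ^ 2 ≤ ε ^ 2 := by
        refine (A_bound d σ S A hA hAt hSle u).trans ?_
        have : ε ^ 2 = σ ^ 2 * t ^ 2 := by rw [ht]; field_simp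
        rw [this]; gcongr
      have hyb : y ∈ {x : Fin d → ℝ | ∑ i, x i ^ 2 ≤ (R + ε) ^ 2} :=
        sq_ball_add d μ (A.mulVec u) R ε hR.le hε.le hμ hAu
      have hRR : R ^ 2 ≤ (R + ε) ^ 2 := by gcongr; linarith
      have hzb := hsc.1 hyb (show x ∈ {x : Fin d → ℝ | ∑ i, x i ^ 2 ≤ (R + ε) ^ 2} from
        hx.trans hRR) (by linarith : 0 ≤ 1 - lam) hlam0.le (by ring)
      have hzb' := hsc.1 hyb (show x' ∈ {x : Fin d → ℝ | ∑ i, x i ^ 2 ≤ (R + ε) ^ 2} from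
        hx'.trans hRR) (by linarith : 0 ≤ 1 - lam) hlam0.le (by ring)
      have h := hsc.2 hzb hzb' ha hb hab
      rw [← hz, ← hz'] at h
      simp only [smul_eq_mul] at h
      rw [sumsq_comb d a b hab] at h
      have hdz : ∑ i, (z i - z' i) ^ 2 = lam ^ 2 * D := by
        rw [hD, Finset.mul_sum]
        refine Finset.sum_congr rfl fun i _ => ?_
        simp only [hz, hz', Pi.add_apply, Pi.smul_apply, smul_eq_mul]; ring
      rw [hdz] at h
      have h5 : lam * c * (1 - q / t ^ 2) ≤ lam * c := by
        have : 0 ≤ q / t ^ 2 := by positivity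
        have h6 : 0 ≤ lam * c := by positivity
        nlinarith
      have h7 : lam * c = α / 2 * (a * b * (lam ^ 2 * D)) := by rw [hc]; ring
      linarith
    · have h := hconv.2 (Set.mem_univ z) (Set.mem_univ z') ha hb hab
      simp only [smul_eq_mul] at h
      have : 1 ≤ q / t ^ 2 := by
        rw [le_div_iff₀ (by positivity)]; linarith
      have h6 : 0 ≤ lam * c := by positivity
      nlinarith
  -- integrate
  have hint : ∫ u, F (a • x + b • x') (μ + A.mulVec u) * stdW d u ≤
      a * (∫ u, F x (μ + A.mulVec u) * stdW d u) + b * (∫ u, F x' (μ + A.mulVec u) * stdW d u)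
        - c * (1 - d / t ^ 2) := by
    have i1 := (hFint x).const_mul a
    have i2 := (hFint x').const_mul b
    have i3 := (stdW_integrable d).const_mul c
    have i4 := (sumsq_stdW_integrable d).const_mul (c / t ^ 2)
    have hE : a * (∫ u, F x (μ + A.mulVec u) * stdW d u) +
        b * (∫ u, F x' (μ + A.mulVec u) * stdW d u) - c * (1 - d / t ^ 2) =
        ∫ u, ((a * (F x (μ + A.mulVec u) * stdW d u) + b * (F x' (μ + A.mulVec u) * stdW d u))
          - (c * stdW d u - c / t ^ 2 * ((∑ i, u i ^ 2) * stdW d u))) := by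
      rw [integral_sub (by exact i1.add i2) (by exact i3.sub i4), integral_add i1 i2,
        integral_sub i3 i4]
      simp only [integral_const_mul, stdW_integral, sumsq_stdW_integral]
      ring
    rw [hE]
    refine integral_mono (hFint _) ((i1.add i2).sub (i3.sub i4)) fun u => ?_
    have := mul_le_mul_of_nonneg_right (hpt u) (stdW_nonneg d u)
    refine this.trans (le_of_eq ?_)
    ring
  have hhalf : (d : ℝ) / t ^ 2 ≤ 1 / 2 := by
    rw [div_le_iff₀ (by positivity)]
    nlinarith
  have hfin : c / 2 ≤ c * (1 - d / t ^ 2) := by nlinarith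
  simp only [smul_eq_mul]
  rw [sumsq_comb d a b hab]
  have hc2 : c / 2 = lam * α / 4 * (a * b * D) := by rw [hc]; ring
  simp only [F] at hint
  rw [← hD]
  linarith
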